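/- arXiv:2310.14635 — 8 statements merged into one kernel-verified Lean document; each statement's English description precedes it below -/
import Mathlib

section
/- Let n ≥ 1 be an integer, 0 < ξ_i < ξ_e, and ζ0 ∈ ℝ arbitrary. Set A = sinh(nξ_e) − e^{n(ξ_i−ξ_e)} sinh(nξ_i), and define p_in, p_out as the interior and exterior pressures, and φ(ξ, η) = (cosh(nξ) + e^{nξ_i} sinh(nξ_i) e^{−nξ}) cos(nη). Then for every η, ∂p_out/∂ξ (ξ_e, η) − ∂p_in/∂ξ (ξ_e, η) = 12 ζ0 · ∂φ/∂ξ (ξ_e, η) = 12 ζ0 n A cos(nη); that is, the piecewise-defined pressure field satisfies the flux-jump transmission condition across the interface ξ = ξ_e for every value of ζ0. -/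
open Real

/-- Flux-jump transmission condition across the interface `ξ = ξₑ` for confocal
ellipses, for every value of the zeta potential `ζ0`:
`∂_ξ p_out(ξₑ, η) − ∂_ξ p_in(ξₑ, η) = 12 ζ0 ∂_ξ φ(ξₑ, η) = 12 ζ0 n A cos(nη)`. -/
theorem ellipse_pressure_flux_jump (n : ℕ) (hn : 1 ≤ n) (ξi ξe : ℝ) (hi : 0 < ξi)
    (hie : ξi < ξe) (ζ0 : ℝ) (A : ℝ)
    (hA : A = Real.sinh (n * ξe) - Real.exp (n * (ξi - ξe)) * Real.sinh (n * ξi))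
    (p_in p_out φ : ℝ → ℝ → ℝ)
    (hin : ∀ ξ η : ℝ,
      p_in ξ η = -12 * Real.exp (-(n * ξe)) * (A * ζ0 - Real.exp (n * ξe)) *
        (Real.cosh (n * ξ) + Real.exp (n * ξi) * Real.sinh (n * ξi) * Real.exp (-(n * ξ))) *
        Real.cos (n * η))
    (hout : ∀ ξ η : ℝ,
      p_out ξ η = (12 * Real.cosh (n * ξ) -
          12 * (ζ0 * A * Real.cosh (n * (ξe - ξi)) - Real.sinh (n * ξi)) *
            Real.exp (n * (ξi - ξ))) * Real.cos (n * η))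
    (hφ : ∀ ξ η : ℝ,
      φ ξ η = (Real.cosh (n * ξ) +
          Real.exp (n * ξi) * Real.sinh (n * ξi) * Real.exp (-(n * ξ))) * Real.cos (n * η)) :
    ∀ η : ℝ,
      deriv (fun ξ => p_out ξ η) ξe - deriv (fun ξ => p_in ξ η) ξe =
          12 * ζ0 * deriv (fun ξ => φ ξ η) ξe ∧
      deriv (fun ξ => p_out ξ η) ξe - deriv (fun ξ => p_in ξ η) ξe =
          12 * ζ0 * n * A * Real.cos (n * η) := by
  intro η
  have hl : HasDerivAt (fun ξ : ℝ => (n : ℝ) * ξ) (n : ℝ) ξe := by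
    simpa using (hasDerivAt_id ξe).const_mul (n : ℝ)
  have hm : HasDerivAt (fun ξ : ℝ => (n : ℝ) * (ξi - ξ)) (-(n : ℝ)) ξe := by
    simpa using ((hasDerivAt_id ξe).const_sub ξi).const_mul (n : ℝ)
  have hS := hl.cosh.add ((hl.neg.exp).const_mul (Real.exp (n * ξi) * Real.sinh (n * ξi)))
  have e1 : Real.exp (n * (ξi - ξe)) = Real.exp (n * ξi) * Real.exp (-(n * ξe)) := by
    rw [← Real.exp_add]; congr 1; ring
  have hS' : HasDerivAt (fun ξ : ℝ => Real.cosh (n * ξ) +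
      Real.exp (n * ξi) * Real.sinh (n * ξi) * Real.exp (-(n * ξ))) (n * A) ξe := by
    refine hS.congr_deriv ?_
    simp only [Pi.neg_apply]
    rw [hA, e1]; ring
  have d1 : deriv (fun ξ => φ ξ η) ξe = n * A * Real.cos (n * η) := by
    simp only [hφ]
    exact (hS'.mul_const _).deriv
  have d2 : deriv (fun ξ => p_in ξ η) ξe = -12 * Real.exp (-(n * ξe)) *
      (A * ζ0 - Real.exp (n * ξe)) * (n * A) * Real.cos (n * η) := by
    simp only [hin]
    exact ((hS'.const_mul _).mul_const _).deriv
  have d3 := (((hl.cosh.const_mul 12).sub (hm.exp.const_mul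
    (12 * (ζ0 * A * Real.cosh (n * (ξe - ξi)) - Real.sinh (n * ξi))))).mul_const
      (Real.cos (n * η))).deriv
  have d4 : deriv (fun ξ => p_out ξ η) ξe = (12 * (Real.sinh (n * ξe) * n) -
      12 * (ζ0 * A * Real.cosh (n * (ξe - ξi)) - Real.sinh (n * ξi)) *
        (Real.exp (n * (ξi - ξe)) * -n)) * Real.cos (n * η) := by
    simp only [hout]
    exact d3
  have e2 : Real.exp (n * ξe) * Real.exp (-(n * ξe)) = 1 := by
    rw [← Real.exp_add]; simp
  have e3 : Real.exp (n * ξi) * Real.exp (-(n * ξi)) = 1 := by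
    rw [← Real.exp_add]; simp
  have e4 : Real.exp (n * (ξe - ξi)) = Real.exp (n * ξe) * Real.exp (-(n * ξi)) := by
    rw [← Real.exp_add]; congr 1; ring
  have e5 : Real.exp (-(n * (ξe - ξi))) = Real.exp (n * ξi) * Real.exp (-(n * ξe)) := by
    rw [← Real.exp_add]; congr 1; ring
  have key : Real.cosh (n * (ξe - ξi)) * Real.exp (n * (ξi - ξe)) +
      Real.exp (-(n * ξe)) * A = 1 := by
    rw [hA, Real.cosh_eq, Real.sinh_eq, Real.sinh_eq, e1, e4, e5]
    generalize Real.exp (n * ξe) = b at *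
    generalize Real.exp (-(n * ξe)) = b' at *
    generalize Real.exp (n * ξi) = a at *
    generalize Real.exp (-(n * ξi)) = a' at *
    linear_combination (1 / 2 + a * a' / 2) * e2 + (1 / 2 + b' ^ 2 / 2) * e3
  have main : deriv (fun ξ => p_out ξ η) ξe - deriv (fun ξ => p_in ξ η) ξe =
      12 * ζ0 * n * A * Real.cos (n * η) := by
    rw [d4, d2]
    linear_combination (12 * ζ0 * n * A * Real.cos (n * η)) * key
      - 12 * n * Real.cos (n * η) * hA - 12 * n * A * Real.cos (n * η) * e2
  refine ⟨?_, main⟩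
  rw [main, d1]; ring
end

section
/- Let n ≥ 1 be an integer, 0 < ξ_i < ξ_e, and ζ0 ∈ ℝ. Set A = sinh(nξ_e) − e^{n(ξ_i−ξ_e)} sinh(nξ_i) and define p_out(ξ, η) = (12 cosh(nξ) − 12 (ζ0 A cosh(n(ξ_e − ξ_i)) − sinh(nξ_i)) e^{n(ξ_i − ξ)}) cos(nη). Then p_out(ξ, η) = 12 cosh(nξ) cos(nη) for all ξ > ξ_e and all η if and only if ζ0 = sinh(nξ_i) / (A cosh(n(ξ_e − ξ_i))). (Perfect hydrodynamic cloaking: the exterior pressure coincides with the background pressure exactly for the cloaking zeta potential.) -/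
open Real

/-- Perfect hydrodynamic cloaking for confocal ellipses: the exterior pressure
coincides with the background pressure `12 cosh(nξ) cos(nη)` on all of `{ξ > ξₑ}`
if and only if `ζ0 = sinh(nξᵢ) / (A cosh(n(ξₑ − ξᵢ)))`, where
`A = sinh(nξₑ) − e^{n(ξᵢ−ξₑ)} sinh(nξᵢ)`. -/
theorem ellipse_perfect_cloaking (n : ℕ) (hn : 1 ≤ n) (ξi ξe : ℝ) (hi : 0 < ξi)
    (hie : ξi < ξe) (ζ0 : ℝ) (A : ℝ)
    (hA : A = Real.sinh (n * ξe) - Real.exp (n * (ξi - ξe)) * Real.sinh (n * ξi))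
    (p_out : ℝ → ℝ → ℝ)
    (hout : ∀ ξ η : ℝ,
      p_out ξ η = (12 * Real.cosh (n * ξ) -
          12 * (ζ0 * A * Real.cosh (n * (ξe - ξi)) - Real.sinh (n * ξi)) *
            Real.exp (n * (ξi - ξ))) * Real.cos (n * η)) :
    (∀ ξ η : ℝ, ξe < ξ → p_out ξ η = 12 * Real.cosh (n * ξ) * Real.cos (n * η)) ↔
      ζ0 = Real.sinh (n * ξi) / (A * Real.cosh (n * (ξe - ξi))) := by
  have hn0 : (0 : ℝ) < n := by exact_mod_cast hn
  have hs : 0 < Real.sinh (n * ξi) := Real.sinh_pos_iff.2 (mul_pos hn0 hi)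
  have hlt : Real.sinh (n * ξi) < Real.sinh (n * ξe) :=
    Real.sinh_lt_sinh.2 (mul_lt_mul_of_pos_left hie hn0)
  have he : Real.exp (n * (ξi - ξe)) < 1 :=
    Real.exp_lt_one_iff.2 (mul_neg_of_pos_of_neg hn0 (sub_neg.2 hie))
  have hApos : 0 < A := by
    rw [hA]; nlinarith
  have hc := Real.cosh_pos (n * (ξe - ξi))
  rw [eq_div_iff (mul_pos hApos hc).ne']
  constructor
  · intro h
    have h1 := h (ξe + 1) 0 (by linarith)
    rw [hout, mul_zero, Real.cos_zero] at h1
    have hE := Real.exp_pos (n * (ξi - (ξe + 1)))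
    have h2 : (ζ0 * A * Real.cosh (n * (ξe - ξi)) - Real.sinh (n * ξi)) *
        Real.exp (n * (ξi - (ξe + 1))) = 0 := by linarith
    have h3 := (mul_eq_zero.1 h2).resolve_right hE.ne'
    linarith
  · intro h ξ η _
    have h3 : ζ0 * A * Real.cosh (n * (ξe - ξi)) - Real.sinh (n * ξi) = 0 := by linarith
    rw [hout, h3]; ring
end

section
/- Let n ≥ 1 be an integer, 0 < r_i < r_e, and ζ0 ∈ ℝ. Define the density amplitudes K_i = 12 n (r_i^{n−1}/r_e^{2n}) ((r_e^{2n} − r_i^{2n}) ζ0 − 2 r_e^{2n}) and K_e = 12 n ζ0 (r_e^{n−1} − r_i^{2n}/r_e^{n+1}). Then the exterior scattered pressure −(1/(2n)) (r_i^{n+1} K_i + r_e^{n+1} K_e) r^{−n} cos(nθ) vanishes for all r > r_e and all θ — equivalently r_i^{n+1} K_i + r_e^{n+1} K_e = 0 — if and only if ζ0 = 2 r_i^{2n} r_e^{2n} / (r_e^{4n} − r_i^{4n}). (Perfect hydrodynamic cloaking for the concentric annulus.) -/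
open Real

/-- Perfect hydrodynamic cloaking for the concentric annulus: the exterior scattered
pressure `−(1/(2n)) (rᵢ^{n+1} Kᵢ + rₑ^{n+1} Kₑ) r^{−n} cos(nθ)` vanishes for all
`r > rₑ` and all `θ` — equivalently `rᵢ^{n+1} Kᵢ + rₑ^{n+1} Kₑ = 0` — if and only if
`ζ0 = 2 rᵢ^{2n} rₑ^{2n} / (rₑ^{4n} − rᵢ^{4n})`. -/
theorem annulus_perfect_cloaking (n : ℕ) (hn : 1 ≤ n) (ri re ζ0 : ℝ) (h0 : 0 < ri)
    (hre : ri < re) (Ki Ke : ℝ)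
    (hKi : Ki = 12 * n * (ri ^ (n - 1) / re ^ (2 * n)) *
      ((re ^ (2 * n) - ri ^ (2 * n)) * ζ0 - 2 * re ^ (2 * n)))
    (hKe : Ke = 12 * n * ζ0 * (re ^ (n - 1) - ri ^ (2 * n) / re ^ (n + 1))) :
    ((∀ r : ℝ, re < r → ∀ θ : ℝ,
        -(1 / (2 * (n : ℝ))) * (ri ^ (n + 1) * Ki + re ^ (n + 1) * Ke) * (r ^ n)⁻¹ *
          Real.cos (n * θ) = 0) ↔
      ri ^ (n + 1) * Ki + re ^ (n + 1) * Ke = 0) ∧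
    (ri ^ (n + 1) * Ki + re ^ (n + 1) * Ke = 0 ↔
      ζ0 = 2 * ri ^ (2 * n) * re ^ (2 * n) / (re ^ (4 * n) - ri ^ (4 * n))) := by
  have hre0 : 0 < re := h0.trans hre
  have hn0 : (n : ℝ) ≠ 0 := by
    have : n ≠ 0 := by omega
    exact_mod_cast this
  constructor
  · constructor
    · intro h
      have h1 := h (re + 1) (by linarith) 0
      have h2 : ((re + 1) ^ n)⁻¹ ≠ 0 := by positivity
      have h3 : -(1 / (2 * (n : ℝ))) ≠ 0 := by
        apply neg_ne_zero.mpr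
        positivity
      rw [mul_zero, Real.cos_zero, mul_one] at h1
      rcases mul_eq_zero.mp h1 with h4 | h4
      · exact (mul_eq_zero.mp h4).resolve_left h3
      · exact absurd h4 h2
    · intro h r _ θ
      rw [h]
      ring
  · have hlt : ri ^ (2 * n) < re ^ (2 * n) :=
      pow_lt_pow_left₀ hre h0.le (by omega)
    have e1 : ri ^ (n + 1) * ri ^ (n - 1) = ri ^ (2 * n) := by
      rw [← pow_add]; congr 1; omega
    have e2 : re ^ (n + 1) * re ^ (n - 1) = re ^ (2 * n) := by
      rw [← pow_add]; congr 1; omega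
    have e3 : ri ^ (4 * n) = (ri ^ (2 * n)) ^ 2 := by
      rw [← pow_mul]; congr 1; omega
    have e4 : re ^ (4 * n) = (re ^ (2 * n)) ^ 2 := by
      rw [← pow_mul]; congr 1; omega
    have ha : 0 < ri ^ (2 * n) := by positivity
    have hb : 0 < re ^ (2 * n) := by positivity
    have hc : re ^ (n + 1) ≠ 0 := by positivity
    rw [e3, e4]
    have key : ri ^ (n + 1) * Ki + re ^ (n + 1) * Ke =
        12 * n * (ri ^ (2 * n) / re ^ (2 * n) *
          ((re ^ (2 * n) - ri ^ (2 * n)) * ζ0 - 2 * re ^ (2 * n)) +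
          ζ0 * (re ^ (2 * n) - ri ^ (2 * n))) := by
      have e5 : re ^ (n + 1) * (ri ^ (2 * n) / re ^ (n + 1)) = ri ^ (2 * n) :=
        mul_div_cancel₀ _ hc
      rw [hKi, hKe]
      linear_combination (12 * n / re ^ (2 * n) *
        ((re ^ (2 * n) - ri ^ (2 * n)) * ζ0 - 2 * re ^ (2 * n))) * e1 +
        12 * n * ζ0 * e2 - 12 * n * ζ0 * e5
    rw [key]
    generalize ri ^ (2 * n) = a at *
    generalize re ^ (2 * n) = b at *
    have hd : b ^ 2 - a ^ 2 ≠ 0 := by nlinarith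
    have key2 : 12 * (n : ℝ) * (a / b * ((b - a) * ζ0 - 2 * b) + ζ0 * (b - a)) =
        12 * n / b * (ζ0 * (b ^ 2 - a ^ 2) - 2 * a * b) := by
      field_simp
      ring
    have h12 : 12 * (n : ℝ) / b ≠ 0 := by positivity
    rw [key2, eq_div_iff hd, mul_eq_zero, or_iff_right h12, sub_eq_zero]
end

section
/- Let n, m be integers with m ≥ n ≥ 1, let 0 < r_i < r_e, and set ζ0 = 2 r_i^{2n} r_e^{2n} / (r_e^{4n} − r_i^{4n}). For real numbers α₁, α₂, δ₁, δ₂ define the first-order scattering coefficient M¹ = (6 n ζ0 / r_e^{2m}) [ ( r_i^{3m+n−1} + r_e^{2(m−n)} ( r_i^{m+3n−1} + (2/ζ0) r_i^{m+n−1} r_e^{2n} ) ) (α₁ − α₂) − r_e^{m−n−1} ( (r_i^{2(m+n)} + r_e^{2(m+n)}) δ₁ − (r_i^{2m} r_e^{2n} + r_i^{2n} r_e^{2m}) δ₂ ) ], where powers with exponent m−n−1 are integer powers (possibly −1). Then M¹ = 0 if and only if r_i^{m−n−1} (r_i^{2(m+n)} + r_e^{2(m+n)}) (α₁ − α₂)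 − r_e^{m−n−1} (r_i^{2(m+n)} + r_e^{2(m+n)}) δ₁ + r_e^{m+n−1} (r_i^{2m} + r_i^{2n} r_e^{2(m−n)}) δ₂ = 0. -/
/-- Vanishing of the first-order scattering coefficient `M¹` (cos-type background
field, concentric annulus): `M¹ = 0` iff the recursive relation between the inner
Fourier coefficients `α₁ = a_{m−n}, α₂ = a_{m+n}` and the outer Fourier coefficients
`δ₁ = d_{m−n}, δ₂ = d_{m+n}` holds. Powers with possibly negative exponents are
integer powers. -/
theorem annulus_first_order_coefficient_cos (n m : ℤ) (hn : 1 ≤ n) (hm : n ≤ m)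
    (ri re : ℝ) (h0 : 0 < ri) (hre : ri < re) (ζ0 : ℝ)
    (hζ : ζ0 = 2 * ri ^ (2 * n) * re ^ (2 * n) / (re ^ (4 * n) - ri ^ (4 * n)))
    (α₁ α₂ δ₁ δ₂ M : ℝ)
    (hM : M = 6 * (n : ℝ) * ζ0 / re ^ (2 * m) *
      ((ri ^ (3 * m + n - 1) +
          re ^ (2 * (m - n)) *
            (ri ^ (m + 3 * n - 1) + 2 / ζ0 * ri ^ (m + n - 1) * re ^ (2 * n))) *
          (α₁ - α₂) -
        re ^ (m - n - 1) *
          ((ri ^ (2 * (m + n)) + re ^ (2 * (m + n))) * δ₁ -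
            (ri ^ (2 * m) * re ^ (2 * n) + ri ^ (2 * n) * re ^ (2 * m)) * δ₂))) :
    M = 0 ↔
      ri ^ (m - n - 1) * (ri ^ (2 * (m + n)) + re ^ (2 * (m + n))) * (α₁ - α₂) -
          re ^ (m - n - 1) * (ri ^ (2 * (m + n)) + re ^ (2 * (m + n))) * δ₁ +
          re ^ (m + n - 1) * (ri ^ (2 * m) + ri ^ (2 * n) * re ^ (2 * (m - n))) * δ₂ = 0 := by
  have hr : 0 < re := h0.trans hre
  have hlt : ri ^ (4 * n) < re ^ (4 * n) :=
    zpow_lt_zpow_left₀ (by omega) h0.le hre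
  have hd : 0 < re ^ (4 * n) - ri ^ (4 * n) := sub_pos.mpr hlt
  have hz : 0 < ζ0 := by rw [hζ]; positivity
  have hn' : (n : ℝ) ≠ 0 := by
    have : n ≠ 0 := by omega
    exact_mod_cast this
  have hC : 6 * (n : ℝ) * ζ0 / re ^ (2 * m) ≠ 0 := by
    have := hz.ne'
    have : re ^ (2 * m) ≠ 0 := (zpow_pos hr _).ne'
    positivity
  have key : ∀ x : ℝ, 0 < x → ∀ i j k : ℤ, i + j = k → x ^ k = x ^ i * x ^ j := by
    intro x hx i j k h
    rw [← h, zpow_add₀ hx.ne']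
  have e2 : 2 / ζ0 * ri ^ (m + n - 1) * re ^ (2 * n)
      = (re ^ (4 * n) - ri ^ (4 * n)) * ri ^ (m - n - 1) := by
    rw [hζ, key ri h0 (m - n - 1) (2 * n) (m + n - 1) (by ring)]
    have h1 : ri ^ (2 * n) ≠ 0 := (zpow_pos h0 _).ne'
    have h2 : re ^ (2 * n) ≠ 0 := (zpow_pos hr _).ne'
    have h3 := hd.ne'
    generalize ri ^ (2 * n) = u at *
    generalize re ^ (2 * n) = v at *
    generalize re ^ (4 * n) - ri ^ (4 * n) = w at *
    field_simp
  rw [hM, mul_eq_zero, or_iff_right hC, e2,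
    key ri h0 (m - n - 1) (2 * (m + n)) (3 * m + n - 1) (by ring),
    key ri h0 (m - n - 1) (4 * n) (m + 3 * n - 1) (by ring),
    key re hr (2 * (m - n)) (4 * n) (2 * (m + n)) (by ring),
    key re hr (m - n - 1) (2 * n) (m + n - 1) (by ring),
    key re hr (2 * (m - n)) (2 * n) (2 * m) (by ring)]
  apply Eq.congr_left
  generalize ri ^ (m - n - 1) = x1
  generalize re ^ (m - n - 1) = x2
  generalize ri ^ (2 * (m + n)) = x3
  generalize re ^ (2 * (m - n)) = x4
  generalize re ^ (4 * n) = x5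
  generalize ri ^ (4 * n) = x6
  generalize re ^ (2 * n) = x7
  generalize ri ^ (2 * n) = x8
  generalize ri ^ (2 * m) = x9
  ring
end

section
/- Let n, m be integers with m ≥ n ≥ 1, let 0 < r_i < r_e, and set ζ0 = 2 r_i^{2n} r_e^{2n} / (r_e^{4n} − r_i^{4n}). For real numbers α₁, α₂, δ₁, δ₂ define the first-order scattering coefficient for the sin-type background field M¹ = (6 n ζ0 / r_e^{2m}) [ ( r_i^{3m+n−1} + r_e^{2(m−n)} ( r_i^{m+3n−1} + (2/ζ0) r_i^{m+n−1} r_e^{2n} ) ) (α₁ + α₂) − r_e^{m−n−1} ( (r_i^{2(m+n)} + r_e^{2(m+n)}) δ₁ + (r_i^{2m} r_e^{2n} + r_i^{2n} r_e^{2m}) δ₂ ) ], where powers with exponent m−n−1 are integer powers (possibly −1). Then M¹ = 0 if and only if r_i^{m−n−1} (r_i^{2(m+n)} + r_e^{2(m+n)}) (α₁ + α₂) − r_e^{m−n−1} (r_i^{2(m+n)} + r_e^{2(m+n)}) δ₁ − r_e^{m+n−1} (r_i^{2m} + r_i^{2n} r_e^{2(m−n)}) δ₂ = 0. -/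
/-- Vanishing of the first-order scattering coefficient `M¹` (sin-type background
field, concentric annulus): `M¹ = 0` iff the recursive relation between the inner
Fourier coefficients `α₁ = a_{m−n}, α₂ = a_{m+n}` and the outer Fourier coefficients
`δ₁ = d_{m−n}, δ₂ = d_{m+n}` holds. Powers with possibly negative exponents are
integer powers. -/
theorem annulus_first_order_coefficient_sin (n m : ℤ) (hn : 1 ≤ n) (hm : n ≤ m)
    (ri re : ℝ) (h0 : 0 < ri) (hre : ri < re) (ζ0 : ℝ)
    (hζ : ζ0 = 2 * ri ^ (2 * n) * re ^ (2 * n) / (re ^ (4 * n) - ri ^ (4 * n)))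
    (α₁ α₂ δ₁ δ₂ M : ℝ)
    (hM : M = 6 * (n : ℝ) * ζ0 / re ^ (2 * m) *
      ((ri ^ (3 * m + n - 1) +
          re ^ (2 * (m - n)) *
            (ri ^ (m + 3 * n - 1) + 2 / ζ0 * ri ^ (m + n - 1) * re ^ (2 * n))) *
          (α₁ + α₂) -
        re ^ (m - n - 1) *
          ((ri ^ (2 * (m + n)) + re ^ (2 * (m + n))) * δ₁ +
            (ri ^ (2 * m) * re ^ (2 * n) + ri ^ (2 * n) * re ^ (2 * m)) * δ₂))) :
    M = 0 ↔
      ri ^ (m - n - 1) * (ri ^ (2 * (m + n)) + re ^ (2 * (m + n))) * (α₁ + α₂) -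
          re ^ (m - n - 1) * (ri ^ (2 * (m + n)) + re ^ (2 * (m + n))) * δ₁ -
          re ^ (m + n - 1) * (ri ^ (2 * m) + ri ^ (2 * n) * re ^ (2 * (m - n))) * δ₂ = 0 := by
  have h1 : 0 < re := h0.trans hre
  have hi : ri ≠ 0 := h0.ne'
  have he : re ≠ 0 := h1.ne'
  have hlt : ri ^ (4 * n) < re ^ (4 * n) :=
    zpow_lt_zpow_left₀ (by omega) h0.le hre
  have hD : re ^ (4 * n) - ri ^ (4 * n) ≠ 0 := (sub_pos.mpr hlt).ne'
  have hz : ζ0 ≠ 0 := by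
    rw [hζ]
    have := zpow_pos h0 (2 * n)
    have := zpow_pos h1 (2 * n)
    exact div_ne_zero (by positivity) hD
  have hn0 : (n : ℝ) ≠ 0 := by
    have : n ≠ 0 := by omega
    exact_mod_cast this
  have hpre : 6 * (n : ℝ) * ζ0 / re ^ (2 * m) ≠ 0 :=
    div_ne_zero (by positivity) (zpow_ne_zero _ he)
  have h2 : 2 / ζ0 = (re ^ (4 * n) - ri ^ (4 * n)) / (ri ^ (2 * n) * re ^ (2 * n)) := by
    have := zpow_ne_zero (2 * n) hi
    have := zpow_ne_zero (2 * n) he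
    rw [hζ]
    field_simp
  have hz2 : ∀ x : ℝ, ∀ k : ℤ, x ^ (2 * k) = (x ^ k) ^ 2 := fun x k => by
    rw [mul_comm, zpow_mul]; norm_cast
  have hz3 : ∀ x : ℝ, ∀ k : ℤ, x ^ (3 * k) = (x ^ k) ^ 3 := fun x k => by
    rw [mul_comm, zpow_mul]; norm_cast
  have hz4 : ∀ x : ℝ, ∀ k : ℤ, x ^ (4 * k) = (x ^ k) ^ 4 := fun x k => by
    rw [mul_comm, zpow_mul]; norm_cast
  rw [hM, mul_eq_zero, or_iff_right hpre, h2]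
  apply Eq.congr_left
  simp only [zpow_sub₀ hi, zpow_sub₀ he, zpow_add₀ hi, zpow_add₀ he, hz2, hz3, hz4, zpow_one]
  have a1 := zpow_ne_zero n hi
  have a2 := zpow_ne_zero m hi
  have a3 := zpow_ne_zero n he
  have a4 := zpow_ne_zero m he
  generalize ri ^ n = a at *
  generalize ri ^ m = b at *
  generalize re ^ n = c at *
  generalize re ^ m = d at *
  field_simp
  ring
end

section
/- Let n ≥ 1 and m_max ≥ 0 be integers, let 0 < r_i < r_e, and let a : ℕ → ℝ satisfy a_m = 0 for all m > m_max. For m ∈ ℕ set ρ_m = (r_i^{2(m+n)} r_e^{2n} + r_i^{2n} r_e^{2(m+n)}) / (r_i^{2(m+2n)} + r_e^{2(m+2n)}) and e_m = (r_i/r_e)^{m−1} (a_m − a_{m+2n}), where (r_i/r_e)^{m−1} denotes the integer power with exponent m−1 (equal to r_e/r_i when m = 0). Then there exists a unique sequence d : ℕ → ℝ such that d_m = 0 for all m > m_max and d_m = ρ_m d_{m+2n} + e_m for every m ∈ ℕ. (This is the recursive construction of the outer shape function achieving 2-order hydrodynamic near-cloaking for the annulus with cos-type background field.) -/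
/-- backward recursion with step `t + 1` -/
noncomputable def annRec (ρ e : ℕ → ℝ) (t M : ℕ) (m : ℕ) : ℝ :=
  if m ≤ M then ρ m * annRec ρ e t M (m + (t + 1)) + e m else 0
termination_by M + 1 - m
decreasing_by omega

/-- Recursive construction of the outer shape function achieving 2-order
hydrodynamic near-cloaking for the annulus with cos-type background field:
given finitely supported inner Fourier coefficients `a`, there exists a unique
sequence `d` vanishing above `m_max` and satisfying
`d_m = ρ_m d_{m+2n} + (rᵢ/rₑ)^{m−1} (a_m − a_{m+2n})` for every `m`. -/
theorem annulus_recursion_cos (n mmax : ℕ) (hn : 1 ≤ n) (ri re : ℝ) (h0 : 0 < ri)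
    (hre : ri < re) (a : ℕ → ℝ) (ha : ∀ m : ℕ, mmax < m → a m = 0)
    (ρ e : ℕ → ℝ)
    (hρ : ∀ m : ℕ, ρ m = (ri ^ (2 * (m + n)) * re ^ (2 * n) +
        ri ^ (2 * n) * re ^ (2 * (m + n))) /
      (ri ^ (2 * (m + 2 * n)) + re ^ (2 * (m + 2 * n))))
    (he : ∀ m : ℕ, e m = (ri / re) ^ ((m : ℤ) - 1) * (a m - a (m + 2 * n))) :
    ∃! d : ℕ → ℝ,
      (∀ m : ℕ, mmax < m → d m = 0) ∧ ∀ m : ℕ, d m = ρ m * d (m + 2 * n) + e m := by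
  obtain ⟨t, ht⟩ : ∃ t, 2 * n = t + 1 := ⟨2 * n - 1, by omega⟩
  have hez : ∀ m, mmax < m → e m = 0 := by
    intro m hm
    rw [he, ha m hm, ha (m + 2 * n) (by omega)]
    simp
  have hz : ∀ m, mmax < m → annRec ρ e t mmax m = 0 := by
    intro m hm
    rw [annRec, if_neg (by omega)]
  refine ⟨annRec ρ e t mmax, ⟨hz, ?_⟩, ?_⟩
  · intro m
    by_cases hm : m ≤ mmax
    · rw [annRec, if_pos hm, ht]
    · rw [hz m (by omega), hz (m + 2 * n) (by omega), hez m (by omega)]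
      simp
  · rintro d ⟨hd0, hd⟩
    have key : ∀ k m, mmax + 1 - m ≤ k → d m = annRec ρ e t mmax m := by
      intro k
      induction k with
      | zero =>
        intro m hm
        rw [hz m (by omega), hd0 m (by omega)]
      | succ k ih =>
        intro m hm
        by_cases hm' : m ≤ mmax
        · rw [annRec, if_pos hm', hd m, ht, ih _ (by omega)]
        · rw [hz m (by omega), hd0 m (by omega)]
    funext m
    exact key _ m le_rfl
end

section
/- Let n, m be integers with m ≥ n ≥ 1, let 0 < ξ_i < ξ_e, let c_i, c_e > 0, and set ζ0 = 2 e^{2nξ_i} e^{2nξ_e} (1 − e^{−2nξ_i}) / (e^{4nξ_e} − e^{4nξ_i}) (which is positive). For real numbers α₁, α₂, δ₁, δ₂ define M¹ = 6 n ζ0 [ e^{nξ_i} ( e^{2m(ξ_i−ξ_e)} sinh(mξ_i) + e^{m(ξ_i−ξ_e)} cosh(mξ_e) − e^{mξ_i − nξ_e} ( sinh(nξ_e) − e^{n(ξ_i−ξ_e)} sinh(nξ_i) − ζ0^{−1} e^{nξ_e} ) ) c_i (α₁ − α₂) − ( cosh(nξ_e) + e^{n(ξ_i−ξ_e)} sinh(nξ_i)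 ) ( e^{m(ξ_i−ξ_e)} sinh(mξ_i) + cosh(mξ_e) ) c_e (δ₁ − δ₂) + ( sinh(nξ_e) − e^{n(ξ_i−ξ_e)} sinh(nξ_i) ) ( e^{m(ξ_i−ξ_e)} cosh(mξ_i) − cosh(mξ_e) ) c_e (δ₁ + δ₂) ]. Then M¹ = 0 if and only if e^{(m+n)ξ_i + (m−n)ξ_e} ( (e^{2nξ_e} − e^{2nξ_i}) (e^{2nξ_e} + 1)/(e^{2nξ_i} − 1) + e^{−2(m−n)ξ_e} (e^{2mξ_i} + e^{2mξ_e}) ) c_i (α₁ − α₂) − (e^{2(m+n)ξ_i} + e^{2(m+n)ξ_e}) c_e δ₁ + (e^{2mξ_i + 2nξ_e} + e^{2mξ_e + 2nξ_i}) c_e δ₂ = 0. -/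
set_option maxHeartbeats 2000000 in
/-- Vanishing of the first-order scattering coefficient `M¹` (cos-type background
field, confocal ellipses): `M¹ = 0` iff the recursive relation between the inner
Fourier coefficients `α₁ = a_{m−n}, α₂ = a_{m+n}` and the outer Fourier coefficients
`δ₁ = d_{m−n}, δ₂ = d_{m+n}` holds; also the perfect-cloaking zeta potential `ζ0`
is positive. -/
theorem ellipse_first_order_coefficient_cos (n m : ℕ) (hn : 1 ≤ n) (hm : n ≤ m)
    (ξi ξe : ℝ) (hi : 0 < ξi) (hie : ξi < ξe) (ci ce : ℝ) (hci : 0 < ci) (hce : 0 < ce)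
    (ζ0 : ℝ)
    (hζ : ζ0 = 2 * Real.exp (2 * n * ξi) * Real.exp (2 * n * ξe) *
        (1 - Real.exp (-(2 * n * ξi))) /
      (Real.exp (4 * n * ξe) - Real.exp (4 * n * ξi)))
    (α₁ α₂ δ₁ δ₂ M : ℝ)
    (hM : M = 6 * n * ζ0 *
      (Real.exp (n * ξi) *
          (Real.exp (2 * m * (ξi - ξe)) * Real.sinh (m * ξi) +
            Real.exp (m * (ξi - ξe)) * Real.cosh (m * ξe) -
            Real.exp (m * ξi - n * ξe) *
              (Real.sinh (n * ξe) - Real.exp (n * (ξi - ξe)) * Real.sinh (n * ξi) -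
                ζ0⁻¹ * Real.exp (n * ξe))) * ci * (α₁ - α₂) -
        (Real.cosh (n * ξe) + Real.exp (n * (ξi - ξe)) * Real.sinh (n * ξi)) *
          (Real.exp (m * (ξi - ξe)) * Real.sinh (m * ξi) + Real.cosh (m * ξe)) * ce *
          (δ₁ - δ₂) +
        (Real.sinh (n * ξe) - Real.exp (n * (ξi - ξe)) * Real.sinh (n * ξi)) *
          (Real.exp (m * (ξi - ξe)) * Real.cosh (m * ξi) - Real.cosh (m * ξe)) * ce *
          (δ₁ + δ₂))) :
    0 < ζ0 ∧
    (M = 0 ↔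
      Real.exp (((m : ℝ) + n) * ξi + ((m : ℝ) - n) * ξe) *
          ((Real.exp (2 * n * ξe) - Real.exp (2 * n * ξi)) *
              (Real.exp (2 * n * ξe) + 1) / (Real.exp (2 * n * ξi) - 1) +
            Real.exp (-(2 * ((m : ℝ) - n) * ξe)) *
              (Real.exp (2 * m * ξi) + Real.exp (2 * m * ξe))) * ci * (α₁ - α₂) -
        (Real.exp (2 * ((m : ℝ) + n) * ξi) + Real.exp (2 * ((m : ℝ) + n) * ξe)) * ce * δ₁ +
        (Real.exp (2 * m * ξi + 2 * n * ξe) + Real.exp (2 * m * ξe + 2 * n * ξi)) * ce * δ₂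
        = 0) := by
  have hn0 : (0:ℝ) < n := by exact_mod_cast hn
  obtain ⟨a, ha⟩ : ∃ a, a = Real.exp (n * ξi) := ⟨_, rfl⟩
  obtain ⟨b, hb⟩ : ∃ b, b = Real.exp (n * ξe) := ⟨_, rfl⟩
  obtain ⟨p, hp⟩ : ∃ p, p = Real.exp (m * ξi) := ⟨_, rfl⟩
  obtain ⟨q, hq⟩ : ∃ q, q = Real.exp (m * ξe) := ⟨_, rfl⟩
  have a1 : 1 < a := by rw [ha]; exact Real.one_lt_exp_iff.mpr (mul_pos hn0 hi)
  have hab : a < b := by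
    rw [ha, hb]; exact Real.exp_lt_exp.mpr (mul_lt_mul_of_pos_left hie hn0)
  have p0 : 0 < p := by rw [hp]; exact Real.exp_pos _
  have q0 : 0 < q := by rw [hq]; exact Real.exp_pos _
  have a0 : 0 < a := by linarith
  have b0 : 0 < b := by linarith
  have e1 : Real.exp (2 * n * ξi) = a ^ 2 := by
    rw [ha, ← Real.exp_nat_mul]; congr 1; push_cast; ring
  have e2 : Real.exp (2 * n * ξe) = b ^ 2 := by
    rw [hb, ← Real.exp_nat_mul]; congr 1; push_cast; ring
  have e3 : Real.exp (4 * n * ξi) = a ^ 4 := by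
    rw [ha, ← Real.exp_nat_mul]; congr 1; push_cast; ring
  have e4 : Real.exp (4 * n * ξe) = b ^ 4 := by
    rw [hb, ← Real.exp_nat_mul]; congr 1; push_cast; ring
  have e5 : Real.exp (2 * m * ξi) = p ^ 2 := by
    rw [hp, ← Real.exp_nat_mul]; congr 1; push_cast; ring
  have e6 : Real.exp (2 * m * ξe) = q ^ 2 := by
    rw [hq, ← Real.exp_nat_mul]; congr 1; push_cast; ring
  have e7 : Real.exp (m * (ξi - ξe)) = p / q := by
    rw [hp, hq, ← Real.exp_sub]; congr 1; ring
  have e8 : Real.exp (2 * m * (ξi - ξe)) = p ^ 2 / q ^ 2 := by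
    rw [← e5, ← e6, ← Real.exp_sub]; congr 1; ring
  have e9 : Real.exp (n * (ξi - ξe)) = a / b := by
    rw [ha, hb, ← Real.exp_sub]; congr 1; ring
  have e10 : Real.exp (m * ξi - n * ξe) = p / b := by
    rw [hp, hb, ← Real.exp_sub]
  have e11 : Real.exp (((m : ℝ) + n) * ξi + ((m : ℝ) - n) * ξe) = p * a * q / b := by
    rw [hp, ha, hq, hb, ← Real.exp_add, ← Real.exp_add, ← Real.exp_sub]; congr 1; ring
  have e12 : Real.exp (-(2 * ((m : ℝ) - n) * ξe)) = b ^ 2 / q ^ 2 := by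
    rw [← e2, ← e6, ← Real.exp_sub]; congr 1; ring
  have e13 : Real.exp (2 * ((m : ℝ) + n) * ξi) = p ^ 2 * a ^ 2 := by
    rw [← e5, ← e1, ← Real.exp_add]; congr 1; ring
  have e14 : Real.exp (2 * ((m : ℝ) + n) * ξe) = q ^ 2 * b ^ 2 := by
    rw [← e6, ← e2, ← Real.exp_add]; congr 1; ring
  have e15 : Real.exp (2 * m * ξi + 2 * n * ξe) = p ^ 2 * b ^ 2 := by
    rw [Real.exp_add, e5, e2]
  have e16 : Real.exp (2 * m * ξe + 2 * n * ξi) = q ^ 2 * a ^ 2 := by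
    rw [Real.exp_add, e6, e1]
  have a2 : 0 < a ^ 2 - 1 := by nlinarith
  have ab2 : 0 < b ^ 2 - a ^ 2 := by nlinarith
  have ab4 : 0 < b ^ 4 - a ^ 4 := by
    have : b ^ 4 - a ^ 4 = (b ^ 2 - a ^ 2) * (b ^ 2 + a ^ 2) := by ring
    rw [this]; exact mul_pos ab2 (add_pos (pow_pos b0 2) (pow_pos a0 2))
  have hζ' : ζ0 = 2 * b ^ 2 * (a ^ 2 - 1) / (b ^ 4 - a ^ 4) := by
    rw [hζ, Real.exp_neg, e1, e2, e3, e4]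
    congr 1
    field_simp
  have hpos : 0 < ζ0 := by rw [hζ']; exact div_pos (mul_pos (mul_pos two_pos (pow_pos b0 2)) a2) ab4
  have hinv : ζ0⁻¹ = (b ^ 2 - a ^ 2) * (b ^ 2 + a ^ 2) / (2 * b ^ 2 * (a ^ 2 - 1)) := by
    rw [hζ', inv_div]; congr 1; ring
  refine ⟨hpos, ?_⟩
  rw [e11, e2, e1, e12, e5, e6, e13, e14, e15, e16]
  rw [hinv] at hM
  simp only [Real.sinh_eq, Real.cosh_eq, Real.exp_neg, e7, e8, e9, e10, ← ha, ← hb, ← hp, ← hq]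
    at hM
  clear hinv hζ' hζ
  have key : M = 6 * n * ζ0 / (2 * b * q) * (p * a * q / b *
      ((b ^ 2 - a ^ 2) * (b ^ 2 + 1) / (a ^ 2 - 1) + b ^ 2 / q ^ 2 * (p ^ 2 + q ^ 2)) * ci *
        (α₁ - α₂) - (p ^ 2 * a ^ 2 + q ^ 2 * b ^ 2) * ce * δ₁ +
        (p ^ 2 * b ^ 2 + q ^ 2 * a ^ 2) * ce * δ₂) := by
    rw [hM]
    have := a2.ne'
    field_simp
    ring
  rw [key, mul_eq_zero]
  have : 6 * (n:ℝ) * ζ0 / (2 * b * q) ≠ 0 :=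
    (div_pos (mul_pos (mul_pos (by norm_num) hn0) hpos) (mul_pos (mul_pos two_pos b0) q0)).ne'
  simp only [this, false_or]
end

section
/- Let n, m be integers with m ≥ n ≥ 1, let 0 < ξ_i < ξ_e, let c_i, c_e > 0, and set ζ0 = 2 e^{2nξ_i} e^{2nξ_e} (1 − e^{−2nξ_i}) / (e^{4nξ_e} − e^{4nξ_i}). For real numbers β₁, β₂, η₁, η₂ define M² = 6 n ζ0 [ e^{nξ_i} ( e^{2m(ξ_i−ξ_e)} cosh(mξ_i) + e^{m(ξ_i−ξ_e)} sinh(mξ_e) − e^{mξ_i − nξ_e} ( sinh(nξ_e) − e^{n(ξ_i−ξ_e)} sinh(nξ_i) − ζ0^{−1} e^{nξ_e} ) ) c_i (β₁ − β₂) − ( cosh(nξ_e) + e^{n(ξ_i−ξ_e)} sinh(nξ_i) ) ( e^{m(ξ_i−ξ_e)} cosh(mξ_i) + sinh(mξ_e) ) c_e (η₁ − η₂) + ( sinh(nξ_e) − e^{n(ξ_i−ξ_e)} sinh(nξ_i) ) ( e^{m(ξ_i−ξ_e)} sinh(mξ_i) − sinh(mξ_e) ) c_e (η₁ + η₂) ].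 Then M² = 0 if and only if e^{(m+n)ξ_i + (m−n)ξ_e} ( (e^{2nξ_e} − e^{2nξ_i}) (e^{2nξ_e} + 1)/(e^{2nξ_i} − 1) + e^{−2(m−n)ξ_e} (e^{2mξ_i} + e^{2mξ_e}) ) c_i (β₁ − β₂) − (e^{2(m+n)ξ_i} + e^{2(m+n)ξ_e}) c_e η₁ + (e^{2mξ_i + 2nξ_e} + e^{2mξ_e + 2nξ_i}) c_e η₂ = 0. -/
open Real

/-- Vanishing of the first-order scattering coefficient `M²` (sine part, cos-type
background field, confocal ellipses): `M² = 0` iff the recursive relation between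
the inner Fourier sine coefficients `β₁ = b_{m−n}, β₂ = b_{m+n}` and the outer
Fourier sine coefficients `η₁ = h_{m−n}, η₂ = h_{m+n}` holds. -/
theorem ellipse_first_order_coefficient_sin (n m : ℕ) (hn : 1 ≤ n) (hm : n ≤ m)
    (ξi ξe : ℝ) (hi : 0 < ξi) (hie : ξi < ξe) (ci ce : ℝ) (hci : 0 < ci) (hce : 0 < ce)
    (ζ0 : ℝ)
    (hζ : ζ0 = 2 * Real.exp (2 * n * ξi) * Real.exp (2 * n * ξe) *
        (1 - Real.exp (-(2 * n * ξi))) /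
      (Real.exp (4 * n * ξe) - Real.exp (4 * n * ξi)))
    (β₁ β₂ η₁ η₂ M : ℝ)
    (hM : M = 6 * n * ζ0 *
      (Real.exp (n * ξi) *
          (Real.exp (2 * m * (ξi - ξe)) * Real.cosh (m * ξi) +
            Real.exp (m * (ξi - ξe)) * Real.sinh (m * ξe) -
            Real.exp (m * ξi - n * ξe) *
              (Real.sinh (n * ξe) - Real.exp (n * (ξi - ξe)) * Real.sinh (n * ξi) -
                ζ0⁻¹ * Real.exp (n * ξe))) * ci * (β₁ - β₂) -
        (Real.cosh (n * ξe) + Real.exp (n * (ξi - ξe)) * Real.sinh (n * ξi)) *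
          (Real.exp (m * (ξi - ξe)) * Real.cosh (m * ξi) + Real.sinh (m * ξe)) * ce *
          (η₁ - η₂) +
        (Real.sinh (n * ξe) - Real.exp (n * (ξi - ξe)) * Real.sinh (n * ξi)) *
          (Real.exp (m * (ξi - ξe)) * Real.sinh (m * ξi) - Real.sinh (m * ξe)) * ce *
          (η₁ + η₂))) :
    M = 0 ↔
      Real.exp (((m : ℝ) + n) * ξi + ((m : ℝ) - n) * ξe) *
          ((Real.exp (2 * n * ξe) - Real.exp (2 * n * ξi)) *
              (Real.exp (2 * n * ξe) + 1) / (Real.exp (2 * n * ξi) - 1) +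
            Real.exp (-(2 * ((m : ℝ) - n) * ξe)) *
              (Real.exp (2 * m * ξi) + Real.exp (2 * m * ξe))) * ci * (β₁ - β₂) -
        (Real.exp (2 * ((m : ℝ) + n) * ξi) + Real.exp (2 * ((m : ℝ) + n) * ξe)) * ce * η₁ +
        (Real.exp (2 * m * ξi + 2 * n * ξe) + Real.exp (2 * m * ξe + 2 * n * ξi)) * ce * η₂
        = 0 := by
  have hn0 : (0:ℝ) < n := by exact_mod_cast hn
  obtain ⟨a, ha⟩ : ∃ a, a = Real.exp (n * ξi) := ⟨_, rfl⟩
  obtain ⟨b, hb⟩ : ∃ b, b = Real.exp (n * ξe) := ⟨_, rfl⟩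
  obtain ⟨p, hp⟩ : ∃ p, p = Real.exp (m * ξi) := ⟨_, rfl⟩
  obtain ⟨q, hq⟩ : ∃ q, q = Real.exp (m * ξe) := ⟨_, rfl⟩
  have ha1 : 1 < a := by rw [ha]; exact Real.one_lt_exp_iff.2 (mul_pos hn0 hi)
  have hab : a < b := by
    rw [ha, hb]; exact Real.exp_lt_exp.2 (mul_lt_mul_of_pos_left hie hn0)
  have hp0 : 0 < p := hp ▸ Real.exp_pos _
  have hq0 : 0 < q := hq ▸ Real.exp_pos _
  have e1 : Real.exp (2 * n * ξi) = a ^ 2 := by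
    rw [ha, ← Real.exp_nat_mul]; congr 1; push_cast; ring
  have e2 : Real.exp (2 * n * ξe) = b ^ 2 := by
    rw [hb, ← Real.exp_nat_mul]; congr 1; push_cast; ring
  have e3 : Real.exp (-(2 * n * ξi)) = (a ^ 2)⁻¹ := by rw [Real.exp_neg, e1]
  have e4 : Real.exp (4 * n * ξi) = a ^ 4 := by
    rw [ha, ← Real.exp_nat_mul]; congr 1; push_cast; ring
  have e5 : Real.exp (4 * n * ξe) = b ^ 4 := by
    rw [hb, ← Real.exp_nat_mul]; congr 1; push_cast; ring
  have e6 : Real.exp (2 * m * ξi) = p ^ 2 := by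
    rw [hp, ← Real.exp_nat_mul]; congr 1; push_cast; ring
  have e7 : Real.exp (2 * m * ξe) = q ^ 2 := by
    rw [hq, ← Real.exp_nat_mul]; congr 1; push_cast; ring
  have e8 : Real.exp (2 * m * (ξi - ξe)) = p ^ 2 / q ^ 2 := by
    rw [← e6, ← e7, ← Real.exp_sub]; congr 1; ring
  have e9 : Real.exp (m * (ξi - ξe)) = p / q := by
    rw [hp, hq, ← Real.exp_sub]; congr 1; ring
  have e10 : Real.exp (n * (ξi - ξe)) = a / b := by
    rw [ha, hb, ← Real.exp_sub]; congr 1; ring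
  have e11 : Real.exp (m * ξi - n * ξe) = p / b := by
    rw [hp, hb, ← Real.exp_sub]
  have e12 : Real.exp (((m : ℝ) + n) * ξi + ((m : ℝ) - n) * ξe) = p * a * q / b := by
    rw [hp, ha, hq, hb, ← Real.exp_add, ← Real.exp_add, ← Real.exp_sub]; congr 1; ring
  have e13 : Real.exp (-(2 * ((m : ℝ) - n) * ξe)) = b ^ 2 / q ^ 2 := by
    rw [← e2, ← e7, ← Real.exp_sub]; congr 1; ring
  have e14 : Real.exp (2 * ((m : ℝ) + n) * ξi) = p ^ 2 * a ^ 2 := by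
    rw [← e6, ← e1, ← Real.exp_add]; congr 1; ring
  have e15 : Real.exp (2 * ((m : ℝ) + n) * ξe) = q ^ 2 * b ^ 2 := by
    rw [← e7, ← e2, ← Real.exp_add]; congr 1; ring
  have e16 : Real.exp (2 * m * ξi + 2 * n * ξe) = p ^ 2 * b ^ 2 := by
    rw [Real.exp_add, e6, e2]
  have e17 : Real.exp (2 * m * ξe + 2 * n * ξi) = q ^ 2 * a ^ 2 := by
    rw [Real.exp_add, e7, e1]
  simp only [Real.cosh_eq, Real.sinh_eq, Real.exp_neg (_ * _), ← ha, ← hb, ← hp, ← hq,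
    e8, e9, e10, e11] at hM
  rw [e1, e2, e3, e4, e5] at hζ
  rw [e12, e1, e2, e13, e6, e7, e14, e15, e16, e17]
  clear e1 e2 e3 e4 e5 e6 e7 e8 e9 e10 e11 e12 e13 e14 e15 e16 e17 ha hb hp hq
  have ha0 : 0 < a := by linarith
  have hb0 : 0 < b := by linarith
  have h1 : 0 < a ^ 2 - 1 := by nlinarith
  have h2 : 0 < b ^ 2 - a ^ 2 := by nlinarith
  have h4 : 0 < b ^ 4 - a ^ 4 := by nlinarith [pow_pos ha0 2, pow_pos hb0 2]
  have hz : ζ0 = 2 * b ^ 2 * (a ^ 2 - 1) / (b ^ 4 - a ^ 4) := by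
    rw [hζ]; field_simp
  have hz0 : 0 < ζ0 := by rw [hz]; positivity
  have hzi : ζ0⁻¹ = (b ^ 4 - a ^ 4) / (2 * b ^ 2 * (a ^ 2 - 1)) := by
    rw [hz, inv_div]
  rw [hzi] at hM
  have key : M = 6 * n * ζ0 / (2 * b * q) * (p * a * q / b *
      ((b ^ 2 - a ^ 2) * (b ^ 2 + 1) / (a ^ 2 - 1) + b ^ 2 / q ^ 2 * (p ^ 2 + q ^ 2)) * ci *
        (β₁ - β₂) - (p ^ 2 * a ^ 2 + q ^ 2 * b ^ 2) * ce * η₁ +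
        (p ^ 2 * b ^ 2 + q ^ 2 * a ^ 2) * ce * η₂) := by
    rw [hM]
    have := h1.ne'
    field_simp
    ring
  have hc : 6 * n * ζ0 / (2 * b * q) ≠ 0 := by positivity
  rw [key, mul_eq_zero, or_iff_right hc]
end
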